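/- arXiv:math/0408200 — 4 statements merged into one kernel-verified Lean document; each statement's English description precedes it below -/
import Mathlib

section
/- There exist a compact metric space X that is zero-dimensional (i.e., has a base of clopen sets, equivalently is totally disconnected) and a closed subset S ⊆ X such that there is no extension operator for Lipschitz pseudometrics from S to X; that is, no map u : PM_Lip(S) → PM_Lip(X) which is additive and positively homogeneous, satisfies u(ρ)|_{S×S} = ρ for every ρ ∈ PM_Lip(S), and has finite norm ‖u‖ = sup{‖u(ρ)‖_X : ‖ρ‖_S ≤ 1}. -/
open Set

section Defs

variable {X : Type*}

/-- `ρ` is a pseudometric on the subset `A`: nonnegative, symmetric,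
vanishing on the diagonal, and satisfying the triangle inequality on `A`. -/
def IsPseudometricOn (A : Set X) (ρ : X → X → ℝ) : Prop :=
  (∀ x ∈ A, ∀ y ∈ A, 0 ≤ ρ x y) ∧
  (∀ x ∈ A, ∀ y ∈ A, ρ x y = ρ y x) ∧
  (∀ x ∈ A, ρ x x = 0) ∧
  (∀ x ∈ A, ∀ y ∈ A, ∀ z ∈ A, ρ x z ≤ ρ x y + ρ y z)

/-- `ρ x y ≤ M * d x y` on `A`; for a Lipschitz pseudometric this says `‖ρ‖_A ≤ M`. -/
def PMNormLE (d : X → X → ℝ) (A : Set X) (ρ : X → X → ℝ) (M : ℝ) : Prop :=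
  ∀ x ∈ A, ∀ y ∈ A, ρ x y ≤ M * d x y

/-- `ρ` is a Lipschitz pseudometric on `A` with respect to the distance `d`. -/
def IsLipPM (d : X → X → ℝ) (A : Set X) (ρ : X → X → ℝ) : Prop :=
  IsPseudometricOn A ρ ∧ ∃ C > 0, PMNormLE d A ρ C

/-- `ρ` is a Lipschitz metric on `A` with respect to the distance `d`. -/
def IsLipM (d : X → X → ℝ) (A : Set X) (ρ : X → X → ℝ) : Prop :=
  IsLipPM d A ρ ∧ ∀ x ∈ A, ∀ y ∈ A, x ≠ y → 0 < ρ x y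

/-- `u` is an extension operator for Lipschitz pseudometrics from `A` to `B`:
it maps Lipschitz pseudometrics on `A` to Lipschitz pseudometrics on `B`,
is additive and positively homogeneous, and `u ρ` restricts to `ρ` on `A × A`. -/
def IsPMExtOp (d : X → X → ℝ) (A B : Set X) (u : (X → X → ℝ) → X → X → ℝ) : Prop :=
  (∀ ρ, IsLipPM d A ρ → IsLipPM d B (u ρ)) ∧
  (∀ ρ₁ ρ₂, IsLipPM d A ρ₁ → IsLipPM d A ρ₂ →
    u (fun x y => ρ₁ x y + ρ₂ x y) = fun x y => u ρ₁ x y + u ρ₂ x y) ∧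
  (∀ c : ℝ, 0 ≤ c → ∀ ρ, IsLipPM d A ρ →
    u (fun x y => c * ρ x y) = fun x y => c * u ρ x y) ∧
  (∀ ρ, IsLipPM d A ρ → ∀ x ∈ A, ∀ y ∈ A, u ρ x y = ρ x y)

/-- `‖u‖ ≤ M` for an operator on Lipschitz pseudometrics:
`‖ρ‖_A ≤ 1` implies `‖u ρ‖_B ≤ M`. -/
def PMOpNormLE (d : X → X → ℝ) (A B : Set X) (u : (X → X → ℝ) → X → X → ℝ) (M : ℝ) : Prop :=
  ∀ ρ, IsLipPM d A ρ → PMNormLE d A ρ 1 → PMNormLE d B (u ρ) M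

/-- `u` is an extension operator for Lipschitz metrics from `A` to `B`. -/
def IsMExtOp (d : X → X → ℝ) (A B : Set X) (u : (X → X → ℝ) → X → X → ℝ) : Prop :=
  (∀ ρ, IsLipM d A ρ → IsLipM d B (u ρ)) ∧
  (∀ ρ₁ ρ₂, IsLipM d A ρ₁ → IsLipM d A ρ₂ →
    u (fun x y => ρ₁ x y + ρ₂ x y) = fun x y => u ρ₁ x y + u ρ₂ x y) ∧
  (∀ c : ℝ, 0 < c → ∀ ρ, IsLipM d A ρ →
    u (fun x y => c * ρ x y) = fun x y => c * u ρ x y) ∧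
  (∀ ρ, IsLipM d A ρ → ∀ x ∈ A, ∀ y ∈ A, u ρ x y = ρ x y)

/-- `‖u‖ ≤ M` for an operator on Lipschitz metrics. -/
def MOpNormLE (d : X → X → ℝ) (A B : Set X) (u : (X → X → ℝ) → X → X → ℝ) (M : ℝ) : Prop :=
  ∀ ρ, IsLipM d A ρ → PMNormLE d A ρ 1 → PMNormLE d B (u ρ) M

/-- `|f x - f y| ≤ M * d x y` on `A`; i.e. the Lipschitz seminorm `‖f‖_A ≤ M`. -/
def FunNormLE (d : X → X → ℝ) (A : Set X) (f : X → ℝ) (M : ℝ) : Prop :=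
  ∀ x ∈ A, ∀ y ∈ A, |f x - f y| ≤ M * d x y

/-- `f` is Lipschitz on `A` with respect to the distance `d`. -/
def IsLipFun (d : X → X → ℝ) (A : Set X) (f : X → ℝ) : Prop :=
  ∃ C > 0, FunNormLE d A f C

/-- `v` is a linear extension operator for Lipschitz functions from `A` to `B`. -/
def IsFunExtOp (d : X → X → ℝ) (A B : Set X) (v : (X → ℝ) → X → ℝ) : Prop :=
  (∀ f, IsLipFun d A f → IsLipFun d B (v f)) ∧
  (∀ f g, IsLipFun d A f → IsLipFun d A g →
    v (fun x => f x + g x) = fun x => v f x + v g x) ∧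
  (∀ c : ℝ, ∀ f, IsLipFun d A f → v (fun x => c * f x) = fun x => c * v f x) ∧
  (∀ f, IsLipFun d A f → ∀ x ∈ A, v f x = f x)

/-- `‖v‖ ≤ M` for an operator on Lipschitz functions. -/
def FunOpNormLE (d : X → X → ℝ) (A B : Set X) (v : (X → ℝ) → X → ℝ) (M : ℝ) : Prop :=
  ∀ f, IsLipFun d A f → FunNormLE d A f 1 → FunNormLE d B (v f) M

/-- `λ(A, B)`: the infimum of the norms of linear extension operators for Lipschitz
functions from `A` to `B` (`⊤` if there is none). -/
noncomputable def lambdaFun (d : X → X → ℝ) (A B : Set X) : ENNReal :=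
  sInf {L : ENNReal | ∃ M : ℝ, L = ENNReal.ofReal M ∧
    ∃ v, IsFunExtOp d A B v ∧ FunOpNormLE d A B v M}

end Defs

theorem sum_add_right_le_sum {G : Type*} [AddGroup G] {f : G → ℝ} (hf : ∀ x, 0 ≤ f x)
    {D D' : Finset G} {c : G} (h : ∀ y ∈ D, y + c ∈ D') :
    ∑ y ∈ D, f (y + c) ≤ ∑ y ∈ D', f y := by
  classical
  rw [← Finset.sum_image (s := D) (g := fun y => y + c) (f := f)
    (fun _ _ _ _ hxy => add_right_cancel hxy)]
  refine Finset.sum_le_sum_of_subset_of_nonneg ?_ fun x _ _ => hf x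
  intro x hx
  obtain ⟨y, hy, rfl⟩ := Finset.mem_image.1 hx
  exact h y hy

/-- The integer points of the half-open cube `[a, b)^ι`. -/
noncomputable def intBox (ι : Type*) [Fintype ι] [DecidableEq ι] (a b : ℤ) : Finset (ι → ℤ) :=
  Fintype.piFinset fun _ => Finset.Ico a b

theorem mem_intBox {ι : Type*} [Fintype ι] [DecidableEq ι] {a b : ℤ} {x : ι → ℤ} :
    x ∈ intBox ι a b ↔ ∀ i, a ≤ x i ∧ x i < b := by
  simp [intBox]

theorem card_intBox {ι : Type*} [Fintype ι] [DecidableEq ι] (a b : ℤ) :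
    (intBox ι a b).card = (b - a).toNat ^ Fintype.card ι := by
  simp [intBox]

theorem sum_intBox_path_le {ι : Type*} [Fintype ι] [DecidableEq ι]
    {V : (ι → ℤ) → (ι → ℤ) → ℝ} (hV : IsPseudometricOn univ V) {v : ι → ℤ}
    (hv : ∀ i, v i = 1 ∨ v i = -1) (R : ℤ) (A : Finset ι) :
    ∑ y ∈ intBox ι 0 R, V y (y + fun i => if i ∈ A then v i else 0) ≤
      ∑ j ∈ A, ∑ y ∈ intBox ι (-1) (R + 1), V y (y + Pi.single j 1) := by
  obtain ⟨h0, hsymm, hself, htri⟩ := hV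
  induction A using Finset.induction_on with
  | empty =>
    have : (fun _ : ι => (0 : ℤ)) = 0 := rfl
    simp [this, hself]
  | insert j A hj ih =>
    rw [Finset.sum_insert hj]
    set p : ι → ℤ := fun i => if i ∈ A then v i else 0 with hp
    have hp' : (fun i => if i ∈ insert j A then v i else 0) = p + Pi.single j (v j) := by
      ext i
      by_cases hij : i = j
      · subst hij; simp [hp, hj]
      · simp [hp, hij]
    have hpj : p j = 0 := by simp [hp, hj]
    have hpb : ∀ i, -1 ≤ p i ∧ p i ≤ 1 := fun i => by
      by_cases hi : i ∈ A
      · rcases hv i with h | h <;> simp [hp, hi, h]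
      · simp [hp, hi]
    rw [hp']
    have hstep : ∑ y ∈ intBox ι 0 R, V (y + p) (y + (p + Pi.single j (v j))) ≤
        ∑ y ∈ intBox ι (-1) (R + 1), V y (y + Pi.single j 1) := by
      rcases hv j with h | h
      · rw [h]
        simp only [← add_assoc]
        refine sum_add_right_le_sum (f := fun y => V y (y + Pi.single j 1))
          (fun y => h0 _ trivial _ trivial) fun y hy => ?_
        rw [mem_intBox] at hy ⊢
        intro i
        have := hy i; have := hpb i
        simp only [Pi.add_apply]; omega
      · rw [h]
        have hc : ∀ y : ι → ℤ, V (y + p) (y + (p + Pi.single j (-1))) =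
            V (y + (p - Pi.single j 1)) (y + (p - Pi.single j 1) + Pi.single j 1) := fun y => by
          rw [hsymm _ trivial _ trivial]
          congr 1
          · rw [Pi.single_neg, sub_eq_add_neg]
          · abel
        simp only [hc]
        refine sum_add_right_le_sum (f := fun y => V y (y + Pi.single j 1))
          (fun y => h0 _ trivial _ trivial) fun y hy => ?_
        rw [mem_intBox] at hy ⊢
        intro i
        have := hy i; have := hpb i
        by_cases hij : i = j
        · subst hij
          simp [hpj]; omega
        · simp [hij]; omega
    calc _ ≤ ∑ y ∈ intBox ι 0 R, (V y (y + p) + V (y + p) (y + (p + Pi.single j (v j)))) :=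
          Finset.sum_le_sum fun y _ => htri _ trivial _ trivial _ trivial
      _ ≤ _ := by rw [Finset.sum_add_distrib]; linarith

theorem sum_intBox_multiple_le {ι G : Type*} [Fintype ι] [DecidableEq ι] [AddCommGroup G]
    {V : G → G → ℝ} (hV : IsPseudometricOn univ V) (φ : (ι → ℤ) →+ G) (y : G) (i : ι)
    (L q : ℕ) :
    ∑ b ∈ intBox ι 0 L, V (y + φ b) (y + φ (b + Pi.single i (q : ℤ))) ≤
      q * ∑ b ∈ intBox ι 0 (L + q), V (y + φ b) (y + φ (b + Pi.single i 1)) := by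
  obtain ⟨h0, -, hself, htri⟩ := hV
  suffices h : ∀ k ≤ q, ∑ b ∈ intBox ι 0 L, V (y + φ b) (y + φ (b + Pi.single i (k : ℤ))) ≤
      k * ∑ b ∈ intBox ι 0 (L + q), V (y + φ b) (y + φ (b + Pi.single i 1)) from h q le_rfl
  intro k
  induction k with
  | zero => simp [hself]
  | succ k ih =>
    intro hk
    have hstep : ∑ b ∈ intBox ι 0 L, V (y + φ (b + Pi.single i (k : ℤ)))
        (y + φ (b + Pi.single i (k : ℤ) + Pi.single i 1)) ≤
        ∑ b ∈ intBox ι 0 (L + q), V (y + φ b) (y + φ (b + Pi.single i 1)) := by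
      refine sum_add_right_le_sum (f := fun b => V (y + φ b) (y + φ (b + Pi.single i 1)))
          (fun y => h0 _ trivial _ trivial) fun b hb => ?_
      rw [mem_intBox] at hb ⊢
      intro j
      have := hb j
      by_cases hij : j = i
      · subst hij
        simp; omega
      · simp [hij]; omega
    have hsplit : (Pi.single i ((k + 1 : ℕ) : ℤ) : ι → ℤ) =
        Pi.single i (k : ℤ) + Pi.single i 1 := by
      rw [← Pi.single_add]; simp
    calc _ ≤ ∑ b ∈ intBox ι 0 L, (V (y + φ b) (y + φ (b + Pi.single i (k : ℤ))) +
            V (y + φ (b + Pi.single i (k : ℤ)))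
              (y + φ (b + Pi.single i (k : ℤ) + Pi.single i 1))) := by
          refine Finset.sum_le_sum fun b _ => ?_
          rw [hsplit, ← add_assoc]
          exact htri _ trivial _ trivial _ trivial
      _ ≤ _ := by
          rw [Finset.sum_add_distrib]
          have := ih (by omega)
          push_cast
          linarith

theorem card_mul_le_of_pseudometrics {ι Ω : Type*} [Fintype ι] [DecidableEq ι]
    [Fintype Ω] [DecidableEq Ω] (φ : (ι → ℤ) →+ (Ω → ℤ))
    (hφ : ∀ i ω, φ (Pi.single i 1) ω = 1 ∨ φ (Pi.single i 1) ω = -1)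
    {V : ι → (Ω → ℤ) → (Ω → ℤ) → ℝ} (hV : ∀ i, IsPseudometricOn univ (V i)) {M K : ℝ}
    (hM : 0 ≤ M) (hVM : ∀ x y, ∑ i, V i x y ≤ M * ∑ ω, |(x ω : ℝ) - y ω|) {R L q : ℕ}
    (hVK : ∀ i, ∀ b ∈ intBox ι 0 L, K * q ≤ V i (φ b) (φ (b + Pi.single i (q : ℤ)))) :
    Fintype.card ι * ((R : ℝ) ^ Fintype.card Ω * ((L : ℝ) ^ Fintype.card ι *
      (K * q - 2 * (M * (Fintype.card Ω * R))))) ≤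
    q * (Fintype.card Ω * ((R + 2 : ℝ) ^ Fintype.card Ω *
      ((L + q : ℝ) ^ Fintype.card ι * M))) := by
  have h0 : ∀ i x y, 0 ≤ V i x y := fun i x y => (hV i).1 x trivial y trivial
  have hle : ∀ i x y, V i x y ≤ M * ∑ ω, |(x ω : ℝ) - y ω| := fun i x y =>
    (Finset.single_le_sum (f := fun i => V i x y) (fun j _ => h0 j x y)
      (Finset.mem_univ i)).trans (hVM x y)
  set W : ι → (Ω → ℤ) → (Ω → ℤ) → ℝ := fun i x y =>
    ∑ b ∈ intBox ι 0 (L + q), V i (x + φ b) (y + φ b) with hW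
  have hWpm : ∀ i, IsPseudometricOn univ (W i) := fun i => by
    obtain ⟨g0, gsymm, gself, gtri⟩ := hV i
    refine ⟨fun x _ y _ => Finset.sum_nonneg fun b _ => h0 _ _ _,
      fun x _ y _ => Finset.sum_congr rfl fun b _ => gsymm _ trivial _ trivial,
      fun x _ => Finset.sum_eq_zero fun b _ => gself _ trivial, fun x _ y _ z _ => ?_⟩
    simp only [hW]
    rw [← Finset.sum_add_distrib]
    exact Finset.sum_le_sum fun b _ => gtri _ trivial _ trivial _ trivial
  have hlow : ∀ i, ∀ y ∈ intBox Ω 0 R, (L : ℝ) ^ Fintype.card ι *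
      (K * q - 2 * (M * (Fintype.card Ω * R))) ≤ q * W i y (y + φ (Pi.single i 1)) := by
    intro i y hy
    obtain ⟨-, gsymm, -, gtri⟩ := hV i
    have hy' : ∑ ω, |(y ω : ℝ)| ≤ Fintype.card Ω * R := by
      calc ∑ ω, |(y ω : ℝ)| ≤ ∑ _ω : Ω, (R : ℝ) := Finset.sum_le_sum fun ω _ => by
            have h := mem_intBox.1 hy ω
            have h1 : (0 : ℝ) ≤ y ω := by exact_mod_cast h.1
            rw [abs_of_nonneg h1]
            exact_mod_cast h.2.le
        _ = _ := by simp
    have hshift : ∀ s, V i s (y + s) ≤ M * (Fintype.card Ω * R) := fun s => by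
      refine (hle i s (y + s)).trans (mul_le_mul_of_nonneg_left ?_ hM)
      simpa using hy'
    have key := sum_intBox_multiple_le (hV i) φ y i L q
    have hW' : W i y (y + φ (Pi.single i 1)) =
        ∑ b ∈ intBox ι 0 (L + q), V i (y + φ b) (y + φ (b + Pi.single i 1)) :=
      Finset.sum_congr rfl fun b _ => by rw [map_add]; congr 1; abel
    rw [hW']
    refine le_trans ?_ key
    have hcard : (L : ℝ) ^ Fintype.card ι = (intBox ι 0 (L : ℤ)).card := by
      rw [card_intBox]; simp
    rw [hcard, ← nsmul_eq_mul]
    refine Finset.card_nsmul_le_sum _ _ _ fun b hb => ?_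
    have h1 := hVK i b hb
    have h2 := gtri (φ b) trivial (y + φ b) trivial (φ (b + Pi.single i (q : ℤ))) trivial
    have h3 := gtri (y + φ b) trivial (y + φ (b + Pi.single i (q : ℤ))) trivial
      (φ (b + Pi.single i (q : ℤ))) trivial
    have h6 := gsymm (y + φ (b + Pi.single i (q : ℤ))) trivial (φ (b + Pi.single i (q : ℤ)))
      trivial
    have h4 := hshift (φ b)
    have h5 := hshift (φ (b + Pi.single i (q : ℤ)))
    linarith
  have hi : ∀ i, (R : ℝ) ^ Fintype.card Ω * ((L : ℝ) ^ Fintype.card ι *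
      (K * q - 2 * (M * (Fintype.card Ω * R)))) ≤
      q * ∑ ω, ∑ y ∈ intBox Ω (-1) (R + 1), W i y (y + Pi.single ω 1) := fun i => by
    have hcard : (R : ℝ) ^ Fintype.card Ω = (intBox Ω 0 (R : ℤ)).card := by
      rw [card_intBox]; simp
    rw [hcard, ← nsmul_eq_mul]
    refine (Finset.card_nsmul_le_sum _ _ _ (hlow i)).trans ?_
    rw [← Finset.mul_sum]
    refine mul_le_mul_of_nonneg_left ?_ (Nat.cast_nonneg q)
    simpa using sum_intBox_path_le (hWpm i) (hφ i) R Finset.univ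
  have hsum := Finset.sum_le_sum fun i (_ : i ∈ (Finset.univ : Finset ι)) => hi i
  rw [Finset.sum_const, nsmul_eq_mul, Finset.card_univ, ← Finset.mul_sum] at hsum
  refine hsum.trans (mul_le_mul_of_nonneg_left ?_ (Nat.cast_nonneg q))
  have hcardR : ((R : ℝ) + 2) ^ Fintype.card Ω = (intBox Ω (-1) ((R : ℤ) + 1)).card := by
    rw [card_intBox, show ((R : ℤ) + 1 - -1).toNat = R + 2 by omega]; push_cast; rfl
  have hcardL : ((L : ℝ) + q) ^ Fintype.card ι = (intBox ι 0 ((L : ℤ) + q)).card := by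
    rw [card_intBox, show ((L : ℤ) + q - 0).toNat = L + q by omega]; push_cast; rfl
  rw [Finset.sum_comm, ← Finset.card_univ, ← nsmul_eq_mul]
  refine Finset.sum_le_card_nsmul _ _ _ fun ω _ => ?_
  rw [Finset.sum_comm, Finset.card_univ, hcardR, ← nsmul_eq_mul]
  refine Finset.sum_le_card_nsmul _ _ _ fun y _ => ?_
  simp only [hW]
  rw [Finset.sum_comm, hcardL, ← nsmul_eq_mul]
  refine Finset.sum_le_card_nsmul _ _ _ fun b _ => ?_
  refine (hVM _ _).trans_eq ?_
  have : ∀ ω', |((y + φ b) ω' : ℝ) - ((y + Pi.single ω 1 + φ b : Ω → ℤ) ω' : ℤ)| =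
      if ω' = ω then 1 else 0 := fun ω' => by
    by_cases h : ω' = ω
    · subst h; simp
    · simp [h]
  rw [Finset.sum_congr rfl fun ω' _ => this ω']
  simp

theorem exists_add_pow_le_two_mul_pow (c N : ℕ) :
    ∃ R : ℕ, 0 < R ∧ ((R : ℝ) + c) ^ N ≤ 2 * (R : ℝ) ^ N := by
  refine ⟨2 * N * c + 1, by omega, ?_⟩
  set R : ℝ := ((2 * N * c + 1 : ℕ) : ℝ) with hR
  have hR' : R = 2 * N * c + 1 := by rw [hR]; push_cast; ring
  have hc : (0 : ℝ) ≤ c := Nat.cast_nonneg c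
  have hN : (0 : ℝ) ≤ N := Nat.cast_nonneg N
  have hNc : 0 ≤ (N : ℝ) * c := by positivity
  have hRpos : 0 < R := by rw [hR']; nlinarith
  have hpos : 0 < R + c := by linarith
  have hb := one_add_mul_le_pow (a := -(c / (R + c))) (by
    have : c / (R + c) ≤ 1 := (div_le_one hpos).2 (by linarith)
    linarith) N
  have h1 : 1 + -(c / (R + c)) = R / (R + c) := by field_simp; ring
  have h2 : (N : ℝ) * (c / (R + c)) ≤ 1 / 2 := by
    rw [← mul_div_assoc, div_le_iff₀ hpos, hR']; nlinarith
  rw [h1, div_pow, le_div_iff₀ (by positivity)] at hb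
  have : 0 < (R + c) ^ N := by positivity
  nlinarith

theorem exists_bound_of_card_mul_lt {ι Ω : Type*} [Fintype ι] [DecidableEq ι]
    [Fintype Ω] [DecidableEq Ω] (φ : (ι → ℤ) →+ (Ω → ℤ))
    (hφ : ∀ i ω, φ (Pi.single i 1) ω = 1 ∨ φ (Pi.single i 1) ω = -1) {M K : ℝ}
    (hM : 0 ≤ M) (hK : 0 < K) (hlt : 8 * Fintype.card Ω * M < Fintype.card ι * K) :
    ∃ B : ℕ, ∀ V : ι → (Ω → ℤ) → (Ω → ℤ) → ℝ,
      (∀ i, IsPseudometricOn {x : Ω → ℤ | ∀ ω, |x ω| ≤ B} (V i)) →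
      (∀ x y : Ω → ℤ, (∀ ω, |x ω| ≤ B) → (∀ ω, |y ω| ≤ B) →
        ∑ i, V i x y ≤ M * ∑ ω, |(x ω : ℝ) - y ω|) →
      ¬ ∀ i, ∀ b b' : ι → ℤ, (∀ ω, |φ b ω| ≤ B) → (∀ ω, |φ b' ω| ≤ B) →
        V i (φ b) (φ b') = K * |(b i : ℝ) - b' i| := by
  set n := Fintype.card ι
  set N := Fintype.card Ω
  obtain ⟨R, hR, hR2⟩ := exists_add_pow_le_two_mul_pow 2 N
  obtain ⟨q, hq⟩ := exists_nat_gt (4 * (M * (N * R)) / K)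
  rw [div_lt_iff₀ hK] at hq
  obtain ⟨L, hL, hL2⟩ := exists_add_pow_le_two_mul_pow q n
  refine ⟨∑ b ∈ intBox ι 0 (L + q), ∑ ω, (φ b ω).natAbs, fun V hV hVM hVK => ?_⟩
  set B : ℕ := ∑ b ∈ intBox ι 0 (L + q), ∑ ω, (φ b ω).natAbs with hB
  have hBφ : ∀ b ∈ intBox ι 0 (L + q), ∀ ω, |φ b ω| ≤ B := fun b hb ω => by
    rw [Int.abs_eq_natAbs]
    exact_mod_cast (Finset.single_le_sum (f := fun ω => (φ b ω).natAbs)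
      (fun _ _ => Nat.zero_le _) (Finset.mem_univ ω)).trans
      (Finset.single_le_sum (f := fun b => ∑ ω, (φ b ω).natAbs)
        (fun _ _ => Nat.zero_le _) hb)
  set c : (Ω → ℤ) → (Ω → ℤ) := fun x ω => max (-B) (min B (x ω)) with hc
  have hcB : ∀ x ω, |c x ω| ≤ B := fun x ω => by
    rw [abs_le]; simp only [hc]; omega
  have hcid : ∀ x : Ω → ℤ, (∀ ω, |x ω| ≤ B) → c x = x := fun x hx => by
    ext ω
    have := abs_le.1 (hx ω)
    simp only [hc]; omega
  have hcle : ∀ x y ω, |(c x ω : ℝ) - c y ω| ≤ |(x ω : ℝ) - y ω| := fun x y ω => by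
    have : |c x ω - c y ω| ≤ |x ω - y ω| := by
      refine (abs_max_sub_max_le_max _ _ _ _).trans (max_le (by simp) ?_)
      exact (abs_min_sub_min_le_max _ _ _ _).trans (max_le (by simp) le_rfl)
    exact_mod_cast this
  have key := card_mul_le_of_pseudometrics φ hφ (V := fun i x y => V i (c x) (c y))
    (fun i => ⟨fun x _ y _ => (hV i).1 _ (hcB x) _ (hcB y),
      fun x _ y _ => (hV i).2.1 _ (hcB x) _ (hcB y), fun x _ => (hV i).2.2.1 _ (hcB x),
      fun x _ y _ z _ => (hV i).2.2.2 _ (hcB x) _ (hcB y) _ (hcB z)⟩) (M := M) (K := K) hM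
    (fun x y => (hVM _ _ (hcB x) (hcB y)).trans (mul_le_mul_of_nonneg_left
      (Finset.sum_le_sum fun ω _ => hcle x y ω) hM)) (R := R) (L := L) (q := q)
    (fun i b hb => by
      rw [mem_intBox] at hb
      have h1 := hBφ b (mem_intBox.2 fun j => by have := hb j; omega)
      have h2 := hBφ (b + Pi.single i (q : ℤ)) (mem_intBox.2 fun j => by
        have := hb j
        by_cases hij : j = i
        · subst hij; simp; omega
        · simp [hij]; omega)
      rw [hcid _ h1, hcid _ h2, hVK i _ _ h1 h2]
      simp)
  change (n : ℝ) * ((R : ℝ) ^ N * ((L : ℝ) ^ n * (K * q - 2 * (M * (N * R))))) ≤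
    q * (N * ((R + 2 : ℝ) ^ N * ((L + q : ℝ) ^ n * M))) at key
  have hRN : (0 : ℝ) < (R : ℝ) ^ N := by positivity
  have hLn : (0 : ℝ) < (L : ℝ) ^ n := by positivity
  have hqpos : (0 : ℝ) < q := by
    have : 0 ≤ 4 * (M * (N * R)) := by positivity
    by_contra h
    nlinarith
  have h1 : (n : ℝ) * ((R : ℝ) ^ N * ((L : ℝ) ^ n * (K * q / 2))) ≤
      (n : ℝ) * ((R : ℝ) ^ N * ((L : ℝ) ^ n * (K * q - 2 * (M * (N * R))))) := by
    gcongr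
    linarith
  have h2 : (q : ℝ) * (N * ((R + 2 : ℝ) ^ N * ((L + q : ℝ) ^ n * M))) ≤
      q * (N * ((2 * (R : ℝ) ^ N) * ((2 * (L : ℝ) ^ n) * M))) := by
    gcongr
    exact_mod_cast hR2
  have h3 := (h1.trans key).trans h2
  have hpos : 0 < (R : ℝ) ^ N * (L : ℝ) ^ n * q / 2 := by positivity
  refine hlt.not_ge (le_of_mul_le_mul_left ?_ hpos)
  linarith

/-- Three pairwise orthogonal sign vectors of length four. -/
def signMatrix (i : Fin 3) (w : Fin 4) : ℤ := if w = i.castSucc then -1 else 1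

theorem two_mul_sum_abs_le_sum_abs_signMatrix (b : Fin 3 → ℝ) :
    2 * ∑ i, |b i| ≤ ∑ w, |∑ i, b i * signMatrix i w| := by
  simp only [Fin.sum_univ_three, Fin.sum_univ_four]
  simp [signMatrix, Fin.ext_iff]
  grind

/-- Tensor powers of `signMatrix`. -/
def signTensor (k : ℕ) (i : Fin k → Fin 3) (ω : Fin k → Fin 4) : ℤ :=
  ∏ j, signMatrix (i j) (ω j)

theorem signTensor_eq (k : ℕ) (i : Fin k → Fin 3) (ω : Fin k → Fin 4) :
    signTensor k i ω = 1 ∨ signTensor k i ω = -1 := by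
  rw [← Int.isUnit_iff]
  refine (IsUnit.prod_univ_iff).2 fun j => ?_
  rw [signMatrix]
  split_ifs <;> decide

theorem sum_signTensor_mul_signTensor (k : ℕ) (i i' : Fin k → Fin 3) :
    ∑ ω, signTensor k i ω * signTensor k i' ω = if i = i' then 4 ^ k else 0 := by
  have h4 : ∀ a a' : Fin 3, ∑ w, signMatrix a w * signMatrix a' w = if a = a' then 4 else 0 := by
    decide
  simp only [signTensor, ← Finset.prod_mul_distrib]
  rw [← Fintype.piFinset_univ, ← Finset.prod_univ_sum (fun _ => Finset.univ)
    fun j w => signMatrix (i j) w * signMatrix (i' j) w]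
  simp only [h4]
  split_ifs with h
  · simp [h]
  · obtain ⟨j, hj⟩ := Function.ne_iff.1 h
    exact Finset.prod_eq_zero (Finset.mem_univ j) (if_neg hj)

theorem sum_fin_succ_arrow {α : Type*} [Fintype α] {k : ℕ} (f : (Fin (k + 1) → α) → ℝ) :
    ∑ x, f x = ∑ a, ∑ y, f (Fin.cons a y) := by
  rw [← Fintype.sum_prod_type', ← (Fin.consEquiv fun _ => α).sum_comp]
  rfl

theorem two_pow_mul_sum_abs_le_sum_abs_signTensor (k : ℕ) (b : (Fin k → Fin 3) → ℝ) :
    2 ^ k * ∑ i, |b i| ≤ ∑ ω, |∑ i, b i * signTensor k i ω| := by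
  induction k with
  | zero => simp [signTensor]
  | succ k ih =>
    have hcons : ∀ a x w y, signTensor (k + 1) (Fin.cons a x) (Fin.cons w y) =
        signMatrix a w * signTensor k x y := fun a x w y => by
      simp [signTensor, Fin.prod_univ_succ]
    simp only [sum_fin_succ_arrow, hcons]
    calc (2 : ℝ) ^ (k + 1) * ∑ a, ∑ x, |b (Fin.cons a x)|
        = 2 * ∑ a, 2 ^ k * ∑ x, |b (Fin.cons a x)| := by rw [← Finset.mul_sum]; ring
      _ ≤ 2 * ∑ a, ∑ y, |∑ x, b (Fin.cons a x) * signTensor k x y| := by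
          gcongr with a
          exact ih fun x => b (Fin.cons a x)
      _ = ∑ y, 2 * ∑ a, |∑ x, b (Fin.cons a x) * signTensor k x y| := by
          rw [Finset.sum_comm, Finset.mul_sum]
      _ ≤ ∑ y, ∑ w, |∑ a, (∑ x, b (Fin.cons a x) * signTensor k x y) * signMatrix a w| :=
          Finset.sum_le_sum fun y _ => two_mul_sum_abs_le_sum_abs_signMatrix _
      _ = _ := by
          rw [Finset.sum_comm]
          refine Finset.sum_congr rfl fun w _ => Finset.sum_congr rfl fun y _ => ?_
          congr 1
          refine Finset.sum_congr rfl fun a _ => ?_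
          rw [Finset.sum_mul]
          refine Finset.sum_congr rfl fun x _ => ?_
          push_cast; ring

theorem IsLipPM.sum {X κ : Type*} {d : X → X → ℝ} {A : Set X} {ρ : κ → X → X → ℝ}
    (hd : ∀ x y, 0 ≤ d x y) (hρ : ∀ i, IsLipPM d A (ρ i)) (s : Finset κ) :
    IsLipPM d A fun x y => ∑ i ∈ s, ρ i x y := by
  refine ⟨⟨fun x hx y hy => Finset.sum_nonneg fun i _ => (hρ i).1.1 x hx y hy,
    fun x hx y hy => Finset.sum_congr rfl fun i _ => (hρ i).1.2.1 x hx y hy,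
    fun x hx => Finset.sum_eq_zero fun i _ => (hρ i).1.2.2.1 x hx,
    fun x hx y hy z hz => ?_⟩, ?_⟩
  · rw [← Finset.sum_add_distrib]
    exact Finset.sum_le_sum fun i _ => (hρ i).1.2.2.2 x hx y hy z hz
  · choose C hC hCρ using fun i => (hρ i).2
    refine ⟨∑ i ∈ s, C i + 1, by
      have := Finset.sum_nonneg fun i (_ : i ∈ s) => (hC i).le
      linarith, fun x hx y hy => ?_⟩
    rw [add_mul, Finset.sum_mul]
    have := Finset.sum_le_sum fun i (_ : i ∈ s) => hCρ i x hx y hy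
    linarith [hd x y]

theorem IsPMExtOp.map_sum {X κ : Type*} {d : X → X → ℝ} {A B : Set X}
    {u : (X → X → ℝ) → X → X → ℝ} (hu : IsPMExtOp d A B u) (hd : ∀ x y, 0 ≤ d x y)
    {ρ : κ → X → X → ℝ} (hρ : ∀ i, IsLipPM d A (ρ i)) (s : Finset κ) :
    u (fun x y => ∑ i ∈ s, ρ i x y) = fun x y => ∑ i ∈ s, u (ρ i) x y := by
  classical
  obtain ⟨-, hadd, hsmul, -⟩ := hu
  induction s using Finset.induction_on with
  | empty => simpa using hsmul 0 le_rfl _ (IsLipPM.sum hd hρ ∅)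
  | insert a s ha ih =>
    simp only [Finset.sum_insert ha]
    rw [hadd _ _ (hρ a) (IsLipPM.sum hd hρ s), ih]

/-- The space `ℓ₁` of functions on `4 ^ k` points. -/
abbrev CubeSpace (k : ℕ) : Type := PiLp 1 fun _ : Fin k → Fin 4 => ℝ

/-- The `ℓ₁`-sum of the spaces `CubeSpace k`. -/
abbrev CubeSum : Type := lp CubeSpace 1

/-- The sign vectors of `signTensor` as elements of `CubeSpace`. -/
def signVector (k : ℕ) (i : Fin k → Fin 3) : CubeSpace k :=
  WithLp.toLp 1 fun ω => (signTensor k i ω : ℝ)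

/-- The coordinate functionals dual to the orthogonal system `signVector`. -/
noncomputable def signCoord (k : ℕ) (i : Fin k → Fin 3) (v : CubeSpace k) : ℝ :=
  (∑ ω, signTensor k i ω * v ω) / 4 ^ k

theorem signCoord_sub (k : ℕ) (i : Fin k → Fin 3) (v w : CubeSpace k) :
    signCoord k i (v - w) = signCoord k i v - signCoord k i w := by
  simp [signCoord, mul_sub, sub_div]

theorem signCoord_sum_smul_signVector (k : ℕ) (b : (Fin k → Fin 3) → ℝ) (i : Fin k → Fin 3) :
    signCoord k i (∑ j, b j • signVector k j) = b i := by
  have h : ∀ j, ∑ ω, (signTensor k i ω : ℝ) * signTensor k j ω = if i = j then 4 ^ k else 0 :=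
    fun j => by exact_mod_cast sum_signTensor_mul_signTensor k i j
  have : ∑ ω, (signTensor k i ω : ℝ) * (∑ j, b j • signVector k j) ω = b i * 4 ^ k := by
    calc _ = ∑ ω, ∑ j, b j * ((signTensor k i ω : ℝ) * signTensor k j ω) := by
          refine Finset.sum_congr rfl fun ω _ => ?_
          simp only [WithLp.ofLp_sum, Finset.sum_apply, WithLp.ofLp_smul, Pi.smul_apply,
            signVector, smul_eq_mul, Finset.mul_sum]
          exact Finset.sum_congr rfl fun j _ => by ring
      _ = ∑ j, b j * if i = j then 4 ^ k else 0 := by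
          rw [Finset.sum_comm]
          simp only [← Finset.mul_sum, h]
      _ = _ := by simp
  rw [signCoord, this, mul_div_cancel_right₀ _ (by positivity)]

theorem sum_abs_signCoord_le_norm {k : ℕ} {v : CubeSpace k}
    (hv : v ∈ Submodule.span ℝ (range (signVector k))) :
    ∑ i, 2 ^ k * |signCoord k i v| ≤ ‖v‖ := by
  obtain ⟨b, rfl⟩ := (Submodule.mem_span_range_iff_exists_fun ℝ).1 hv
  simp only [signCoord_sum_smul_signVector, PiLp.norm_eq_of_L1]
  rw [← Finset.mul_sum]
  refine (two_pow_mul_sum_abs_le_sum_abs_signTensor k b).trans_eq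
    (Finset.sum_congr rfl fun ω _ => ?_)
  simp [signVector]

/-- The lattice generated by the sign vectors. -/
def signLattice (k : ℕ) : ((Fin k → Fin 3) → ℤ) →+ ((Fin k → Fin 4) → ℤ) where
  toFun b ω := ∑ i, b i * signTensor k i ω
  map_zero' := by ext; simp
  map_add' b c := by ext; simp [add_mul, Finset.sum_add_distrib]

/-- The point of `CubeSpace k` with coordinates `t * x ω`. -/
def scaledPoint (k : ℕ) (t : ℝ) (x : (Fin k → Fin 4) → ℤ) : CubeSpace k :=
  WithLp.toLp 1 fun ω => t * x ω

theorem scaledPoint_signLattice (k : ℕ) (t : ℝ) (b : (Fin k → Fin 3) → ℤ) :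
    scaledPoint k t (signLattice k b) = ∑ i, (t * b i) • signVector k i := by
  ext ω
  simp [scaledPoint, signLattice, signVector, Finset.mul_sum, mul_assoc]

theorem norm_scaledPoint_sub {k : ℕ} {t : ℝ} (ht : 0 ≤ t) (x y : (Fin k → Fin 4) → ℤ) :
    ‖scaledPoint k t x - scaledPoint k t y‖ = t * ∑ ω, |(x ω : ℝ) - y ω| := by
  rw [PiLp.norm_eq_of_L1, Finset.mul_sum]
  refine Finset.sum_congr rfl fun ω _ => ?_
  simp [scaledPoint, ← mul_sub, abs_of_nonneg ht]

/-- The scale at which the integer box of radius `B` is placed in `CubeSpace k`. -/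
noncomputable def boxScale (k B : ℕ) : ℝ := 1 / ((k + B + 1) * ((B + 1) * 4 ^ k))

theorem boxScale_pos (k B : ℕ) : 0 < boxScale k B := by
  unfold boxScale; positivity

theorem norm_scaledPoint_boxScale_le {k B : ℕ} {x : (Fin k → Fin 4) → ℤ}
    (hx : ∀ ω, |x ω| ≤ B) : ‖scaledPoint k (boxScale k B) x‖ ≤ 1 / ((k + B : ℕ) + 1) := by
  have h := norm_scaledPoint_sub (boxScale_pos k B).le x 0
  have h0 : scaledPoint k (boxScale k B) 0 = 0 := by ext ω; simp [scaledPoint]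
  rw [h0, sub_zero] at h
  rw [h]
  have : ∑ ω, |(x ω : ℝ) - (0 : (Fin k → Fin 4) → ℤ) ω| ≤ (B + 1) * 4 ^ k := by
    calc _ ≤ ∑ _ω : Fin k → Fin 4, ((B : ℝ) + 1) := Finset.sum_le_sum fun ω _ => by
          have : |(x ω : ℝ)| ≤ B := by exact_mod_cast hx ω
          simp; linarith
      _ = _ := by simp; ring
  calc _ ≤ boxScale k B * ((B + 1) * 4 ^ k) :=
        mul_le_mul_of_nonneg_left this (boxScale_pos k B).le
    _ = _ := by unfold boxScale; push_cast; field_simp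

/-- Scaled integer boxes of all sizes in all the spaces `CubeSpace k`. -/
noncomputable def boxPoint
    (p : Σ k : ℕ, Σ B : ℕ, (Fin k → Fin 4) → Finset.Icc (-B : ℤ) B) : CubeSum :=
  lp.single 1 p.1 (scaledPoint p.1 (boxScale p.1 p.2.1) fun ω => (p.2.2 ω : ℤ))

theorem tendsto_boxPoint : Filter.Tendsto boxPoint Filter.cofinite (nhds 0) := by
  have hfin : Filter.Tendsto (fun p : Σ k : ℕ, Σ B : ℕ, (Fin k → Fin 4) →
      Finset.Icc (-B : ℤ) B => p.1 + p.2.1) Filter.cofinite Filter.atTop := by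
    rw [← Nat.cofinite_eq_atTop]
    refine Filter.Tendsto.cofinite_of_finite_preimage_singleton fun n => ?_
    refine ((Finset.range (n + 1)).sigma fun k => (Finset.range (n + 1)).sigma
      fun B => Finset.univ).finite_toSet.subset ?_
    rintro ⟨k, B, x⟩ h
    simp only [mem_preimage, mem_singleton_iff] at h
    simp only [Finset.coe_sigma, Set.mem_sigma_iff, Finset.mem_coe, Finset.mem_range,
      Finset.mem_univ, and_true]
    omega
  rw [tendsto_zero_iff_norm_tendsto_zero]
  refine squeeze_zero (fun _ => norm_nonneg _) (fun p => ?_)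
    (tendsto_one_div_add_atTop_nhds_zero_nat.comp hfin)
  rw [boxPoint, lp.norm_single one_pos]
  refine norm_scaledPoint_boxScale_le fun ω => ?_
  have := Finset.mem_Icc.1 (p.2.2 ω).2
  exact abs_le.2 this

/-- The compact set formed by all the scaled boxes and their limit point. -/
noncomputable def boxSet : Set CubeSum := insert 0 (range boxPoint)

theorem single_scaledPoint_mem_boxSet {k B : ℕ} {x : (Fin k → Fin 4) → ℤ}
    (hx : ∀ ω, |x ω| ≤ B) :
    lp.single 1 k (scaledPoint k (boxScale k B) x) ∈ boxSet :=
  Or.inr ⟨⟨k, B, fun ω => ⟨x ω, Finset.mem_Icc.2 (abs_le.1 (hx ω))⟩⟩, rfl⟩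

theorem isCompact_boxSet : IsCompact boxSet :=
  tendsto_boxPoint.isCompact_insert_range_of_cofinite

theorem countable_boxSet : boxSet.Countable :=
  (countable_range boxPoint).insert 0

theorem not_exists_extension_operator_boxSet :
    ¬ ∃ (u : (boxSet → boxSet → ℝ) → boxSet → boxSet → ℝ) (M : ℝ),
      IsPMExtOp dist {x : boxSet | ∀ k, x.1 k ∈ Submodule.span ℝ (range (signVector k))}
        univ u ∧
      PMOpNormLE dist {x : boxSet | ∀ k, x.1 k ∈ Submodule.span ℝ (range (signVector k))}
        univ u M := by
  rintro ⟨u, M, hu, huM⟩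
  set S : Set boxSet := {x | ∀ k, x.1 k ∈ Submodule.span ℝ (range (signVector k))} with hS
  obtain ⟨k, hk⟩ := pow_unbounded_of_one_lt (8 * |M|) (show (1 : ℝ) < 3 / 2 by norm_num)
  have hlt : 8 * Fintype.card (Fin k → Fin 4) * |M| <
      Fintype.card (Fin k → Fin 3) * (2 : ℝ) ^ k := by
    have h4 : (0 : ℝ) < 4 ^ k := by positivity
    have h6 : (3 : ℝ) ^ k * 2 ^ k = (3 / 2) ^ k * 4 ^ k := by
      rw [← mul_pow, ← mul_pow]; norm_num
    simp only [Fintype.card_pi_const, Fintype.card_fin, Nat.cast_pow, Nat.cast_ofNat]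
    rw [h6]
    nlinarith
  obtain ⟨B, hB⟩ := exists_bound_of_card_mul_lt (signLattice k) (fun i ω => by
    simpa [signLattice, Pi.single_apply] using signTensor_eq k i ω) (abs_nonneg M)
    (by positivity : (0 : ℝ) < 2 ^ k) hlt
  set t := boxScale k B with ht
  have htpos : 0 < t := boxScale_pos k B
  set ρ : (Fin k → Fin 3) → boxSet → boxSet → ℝ := fun i x y =>
    2 ^ k * |signCoord k i (x.1 k) - signCoord k i (y.1 k)| with hρ
  have hρsum : ∀ x ∈ S, ∀ y ∈ S, ∑ i, ρ i x y ≤ 1 * dist x y := fun x hx y hy => by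
    simp only [hρ, ← signCoord_sub]
    rw [one_mul, Subtype.dist_eq, dist_eq_norm]
    exact (sum_abs_signCoord_le_norm (Submodule.sub_mem _ (hx k) (hy k))).trans
      (lp.norm_apply_le_norm one_ne_zero (x.1 - y.1) k)
  have hρ0 : ∀ i x y, 0 ≤ ρ i x y := fun i x y => by positivity
  have hρlip : ∀ i, IsLipPM dist S (ρ i) := fun i => by
    refine ⟨⟨fun x _ y _ => hρ0 i x y, fun x _ y _ => by simp only [hρ, abs_sub_comm],
      fun x _ => by simp [hρ], fun x _ y _ z _ => ?_⟩, 1, one_pos, fun x hx y hy => ?_⟩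
    · simp only [hρ]
      rw [← mul_add]
      gcongr
      exact abs_sub_le _ _ _
    · exact (Finset.single_le_sum (f := fun i => ρ i x y) (fun j _ => hρ0 j x y)
        (Finset.mem_univ i)).trans (hρsum x hx y hy)
  have husum : ∀ x y, ∑ i, u (ρ i) x y ≤ |M| * dist x y := fun x y => by
    have h := huM _ (IsLipPM.sum (fun _ _ => dist_nonneg) hρlip Finset.univ) hρsum
      x trivial y trivial
    rw [hu.map_sum (fun _ _ => dist_nonneg) hρlip] at h
    exact h.trans (mul_le_mul_of_nonneg_right (le_abs_self M) dist_nonneg)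
  classical
  set P : ((Fin k → Fin 4) → ℤ) → boxSet := fun x =>
    if h : ∀ ω, |x ω| ≤ B then ⟨_, single_scaledPoint_mem_boxSet h⟩ else ⟨0, Or.inl rfl⟩ with hP
  have hPval : ∀ x : (Fin k → Fin 4) → ℤ, (∀ ω, |x ω| ≤ B) →
      (P x).1 = lp.single 1 k (scaledPoint k t x) :=
    fun x hx => by simp only [hP]; rw [dif_pos hx]
  refine hB (fun i x y => u (ρ i) (P x) (P y) / t) (fun i => ?_) (fun x y hx hy => ?_)
    fun i b b' hb hb' => ?_
  · obtain ⟨g0, gsymm, gself, gtri⟩ := (hu.1 _ (hρlip i)).1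
    refine ⟨fun x _ y _ => div_nonneg (g0 _ trivial _ trivial) htpos.le,
      fun x _ y _ => congrArg (· / t) (gsymm _ trivial _ trivial),
      fun x _ => by simp only [gself _ trivial, zero_div], fun x _ y _ z _ => ?_⟩
    rw [← add_div]
    exact div_le_div_of_nonneg_right (gtri _ trivial _ trivial _ trivial) htpos.le
  · rw [← Finset.sum_div, div_le_iff₀ htpos]
    refine (husum _ _).trans_eq ?_
    rw [Subtype.dist_eq, hPval x hx, hPval y hy, dist_eq_norm, ← lp.single_sub,
      lp.norm_single one_pos, norm_scaledPoint_sub htpos.le]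
    ring
  · have hPS : ∀ c, (∀ ω, |signLattice k c ω| ≤ B) → P (signLattice k c) ∈ S :=
      fun c hc l => by
        rw [hPval _ hc]
        by_cases hl : l = k
        · subst hl
          rw [lp.single_apply_self, scaledPoint_signLattice]
          exact Submodule.sum_mem _ fun i _ =>
            Submodule.smul_mem _ _ (Submodule.subset_span ⟨i, rfl⟩)
        · rw [lp.single_apply_ne _ _ _ hl]
          exact Submodule.zero_mem _
    rw [hu.2.2.2 _ (hρlip i) _ (hPS b hb) _ (hPS b' hb')]
    simp only [hρ]
    rw [hPval _ hb, hPval _ hb', lp.single_apply_self, lp.single_apply_self,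
      scaledPoint_signLattice, scaledPoint_signLattice, signCoord_sum_smul_signVector,
      signCoord_sum_smul_signVector, ← mul_sub, abs_mul, abs_of_pos htpos]
    field_simp

/-- There exist a zero-dimensional compact metric space `X` and a closed subset `S ⊆ X`
admitting no continuous linear extension operator for Lipschitz pseudometrics. -/
theorem nonexistence_of_linear_extension_operator_for_Lipschitz_pseudometrics :
    ∃ (X : Type) (_ : MetricSpace X), CompactSpace X ∧ TotallyDisconnectedSpace X ∧
      ∃ S : Set X, IsClosed S ∧
        ¬ ∃ (u : (X → X → ℝ) → X → X → ℝ) (M : ℝ),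
            IsPMExtOp dist S univ u ∧ PMOpNormLE dist S univ u M := by
  refine ⟨boxSet, inferInstance, isCompact_iff_compactSpace.1 isCompact_boxSet,
    totallyDisconnectedSpace_subtype_iff.2 countable_boxSet.isTotallyDisconnected, _, ?_,
    not_exists_extension_operator_boxSet⟩
  simp only [Set.ofPred_forall]
  refine isClosed_iInter fun k => ?_
  exact (Submodule.closed_of_finiteDimensional (Submodule.span ℝ (range (signVector k)))).preimage
    ((lp.evalCLM ℝ CubeSpace 1 k).continuous.comp continuous_subtype_val)
end

section
/- Let (X,d) be a metric space, S ⊆ X, X₁ ⊆ X, S₁ ⊆ X₁, and suppose r : X → X₁ is a 1-Lipschitz retraction (r(x) = x for all x ∈ X₁) with r(S) = S₁ and S₁ ⊆ S. If there exists a linear extension operator for Lipschitz functions from S to X with norm at most M, then there exists a linear extension operator for Lipschitz functions from S₁ to X₁ with norm at most M. Consequently λ(S₁, X₁) ≤ λ(S, X). -/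
open Set

section Comp

variable {X : Type*} [PseudoMetricSpace X] {A A' B B' : Set X} {r : X → X}

theorem FunNormLE.comp_right {f : X → ℝ} {C : ℝ} (hf : FunNormLE dist A' f C) (hC : 0 ≤ C)
    (hr : ∀ x y, dist (r x) (r y) ≤ dist x y) (hmaps : MapsTo r A A') :
    FunNormLE dist A (f ∘ r) C := fun x hx y hy =>
  (hf (r x) (hmaps hx) (r y) (hmaps hy)).trans (mul_le_mul_of_nonneg_left (hr x y) hC)

theorem IsLipFun.comp_right {f : X → ℝ} (hf : IsLipFun dist A' f)
    (hr : ∀ x y, dist (r x) (r y) ≤ dist x y) (hmaps : MapsTo r A A') :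
    IsLipFun dist A (f ∘ r) :=
  let ⟨C, hC, hfC⟩ := hf
  ⟨C, hC, hfC.comp_right hC.le hr hmaps⟩

theorem FunNormLE.mono {f : X → ℝ} {C : ℝ} (hf : FunNormLE dist B f C) (hB : B' ⊆ B) :
    FunNormLE dist B' f C := fun x hx y hy => hf x (hB hx) y (hB hy)

theorem IsLipFun.mono {f : X → ℝ} (hf : IsLipFun dist B f) (hB : B' ⊆ B) :
    IsLipFun dist B' f :=
  let ⟨C, hC, hfC⟩ := hf
  ⟨C, hC, hfC.mono hB⟩

/-- Precomposing the argument of an extension operator with a 1-Lipschitz map `r` from `A` to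
`A'` that fixes `A'` pointwise gives an extension operator from `A'`. -/
theorem IsFunExtOp.comp_right {v : (X → ℝ) → X → ℝ} (hv : IsFunExtOp dist A B v)
    (hr : ∀ x y, dist (r x) (r y) ≤ dist x y) (hmaps : MapsTo r A A') (hA : A' ⊆ A)
    (hfix : ∀ x ∈ A', r x = x) (hB : B' ⊆ B) :
    IsFunExtOp dist A' B' (fun f => v (f ∘ r)) := by
  obtain ⟨hlip, hadd, hsmul, hext⟩ := hv
  refine ⟨fun f hf => (hlip _ (hf.comp_right hr hmaps)).mono hB,
    fun f g hf hg => hadd _ _ (hf.comp_right hr hmaps) (hg.comp_right hr hmaps),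
    fun c f hf => hsmul c _ (hf.comp_right hr hmaps), fun f hf x hx => ?_⟩
  exact (hext _ (hf.comp_right hr hmaps) x (hA hx)).trans (congrArg f (hfix x hx))

theorem FunOpNormLE.comp_right {v : (X → ℝ) → X → ℝ} {L : ℝ} (hv : FunOpNormLE dist A B v L)
    (hr : ∀ x y, dist (r x) (r y) ≤ dist x y) (hmaps : MapsTo r A A') (hB : B' ⊆ B) :
    FunOpNormLE dist A' B' (fun f => v (f ∘ r)) L := fun _ hf hf1 =>
  (hv _ (hf.comp_right hr hmaps) (hf1.comp_right zero_le_one hr hmaps)).mono hB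

end Comp

/-- If `(S₁, X₁)` is a retract of `(S, X)` under a 1-Lipschitz retraction, then a linear
extension operator for Lipschitz functions from `S` to `X` of norm at most `M` yields one
from `S₁` to `X₁` of norm at most `M`; consequently `λ(S₁, X₁) ≤ λ(S, X)`. -/
theorem lambda_monotone_under_one_lipschitz_retraction {X : Type*} [MetricSpace X]
    (S X₁ S₁ : Set X) (r : X → X) (M : ℝ)
    (hrange : ∀ x, r x ∈ X₁) (hretr : ∀ x ∈ X₁, r x = x)
    (hlip : ∀ x y : X, dist (r x) (r y) ≤ dist x y)
    (hrS : r '' S = S₁) (hS₁S : S₁ ⊆ S) (hS₁X₁ : S₁ ⊆ X₁) :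
    ((∃ v, IsFunExtOp (dist : X → X → ℝ) S univ v ∧
        FunOpNormLE (dist : X → X → ℝ) S univ v M) →
      ∃ v, IsFunExtOp (dist : X → X → ℝ) S₁ X₁ v ∧
        FunOpNormLE (dist : X → X → ℝ) S₁ X₁ v M) ∧
    lambdaFun (dist : X → X → ℝ) S₁ X₁ ≤ lambdaFun (dist : X → X → ℝ) S univ := by
  have hmaps : MapsTo r S S₁ := mapsTo_iff_image_subset.2 hrS.subset
  have transfer (L : ℝ) (h : ∃ v, IsFunExtOp (dist : X → X → ℝ) S univ v ∧
      FunOpNormLE (dist : X → X → ℝ) S univ v L) :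
      ∃ v, IsFunExtOp (dist : X → X → ℝ) S₁ X₁ v ∧
        FunOpNormLE (dist : X → X → ℝ) S₁ X₁ v L := by
    obtain ⟨v, hv, hvL⟩ := h
    exact ⟨fun f => v (f ∘ r),
      hv.comp_right hlip hmaps hS₁S (fun x hx => hretr x (hS₁X₁ hx)) (subset_univ X₁),
      hvL.comp_right hlip hmaps (subset_univ X₁)⟩
  refine ⟨transfer M, sInf_le_sInf ?_⟩
  rintro _ ⟨L, rfl, hL⟩
  exact ⟨L, rfl, transfer L hL⟩
end

section
/- Let S be a closed subset of a compact metric space X with at least two points. Then the following are equivalent: (1) there exists a continuous linear extension operator from PM_Lip(S) to PM_Lip(X), i.e., an additive, positively homogeneous map u with u(ρ)|_{S×S} = ρ for all ρ ∈ PM_Lip(S) and finite norm sup{‖u(ρ)‖_X : ‖ρ‖_S ≤ 1}; (2) there exists a continuous linear extension operator from M_Lip(S) to M_Lip(X), i.e., an additive, positively homogeneous map w defined on Lipschitz metrics on S, taking values in Lipschitz metrics on X, with w(ρ)|_{S×S} = ρ for all ρ ∈ M_Lip(S) and finite norm sup{‖w(ρ)‖_X : ρ ∈ M_Lip(S), ‖ρ‖_S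 ≤ 1}. -/
open Set

open Metric in
/-- The pseudometric obtained from the distance by collapsing `S` to a point. -/
noncomputable def collapseDist {X : Type*} [MetricSpace X] (S : Set X) (x y : X) : ℝ :=
  min (dist x y) (infDist x S + infDist y S)

section Collapse

variable {X : Type*} [MetricSpace X] {S : Set X}

theorem collapseDist_le_dist (x y : X) : collapseDist S x y ≤ dist x y :=
  min_le_left _ _

theorem isPseudometricOn_collapseDist : IsPseudometricOn univ (collapseDist S) := by
  have hn (x : X) : 0 ≤ Metric.infDist x S := Metric.infDist_nonneg
  refine ⟨fun x _ y _ => le_min dist_nonneg (add_nonneg (hn x) (hn y)),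
    fun x _ y _ => by simp only [collapseDist, dist_comm x y, add_comm],
    fun x _ => by simp [collapseDist, hn x], fun x _ y _ z _ => ?_⟩
  have h1 := Metric.infDist_le_infDist_add_dist (s := S) (x := x) (y := y)
  have h2 := Metric.infDist_le_infDist_add_dist (s := S) (x := z) (y := y)
  rw [dist_comm z y] at h2
  have h3 := dist_triangle x y z
  have hx := hn x
  have hy := hn y
  have hz := hn z
  unfold collapseDist
  rcases min_cases (dist x y) (Metric.infDist x S + Metric.infDist y S) with h | h <;>
  rcases min_cases (dist y z) (Metric.infDist y S + Metric.infDist z S) with h' | h' <;>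
  rw [h.1, h'.1, min_le_iff]
  · left; linarith
  · right; linarith
  · right; linarith
  · right; linarith

theorem collapseDist_eq_zero {x y : X} (hx : x ∈ S) (hy : y ∈ S) : collapseDist S x y = 0 := by
  simp [collapseDist, Metric.infDist_zero_of_mem hx, Metric.infDist_zero_of_mem hy]

theorem collapseDist_pos (hS : IsClosed S) (hne : S.Nonempty) {x y : X} (hxy : x ≠ y)
    (h : ¬(x ∈ S ∧ y ∈ S)) : 0 < collapseDist S x y := by
  refine lt_min (dist_pos.2 hxy) ?_
  have hn (z : X) : 0 ≤ Metric.infDist z S := Metric.infDist_nonneg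
  rcases not_and_or.1 h with h | h
  · exact add_pos_of_pos_of_nonneg ((hS.notMem_iff_infDist_pos hne).1 h) (hn y)
  · exact add_pos_of_nonneg_of_pos (hn x) ((hS.notMem_iff_infDist_pos hne).1 h)

end Collapse

section Cone

variable {X : Type*} {A : Set X} {ρ σ : X → X → ℝ}

theorem IsPseudometricOn.add (hρ : IsPseudometricOn A ρ) (hσ : IsPseudometricOn A σ) :
    IsPseudometricOn A fun x y => ρ x y + σ x y := by
  obtain ⟨n, s, z, t⟩ := hρ
  obtain ⟨n', s', z', t'⟩ := hσ
  refine ⟨fun x hx y hy => add_nonneg (n x hx y hy) (n' x hx y hy),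
    fun x hx y hy => by simp only [s x hx y hy, s' x hx y hy],
    fun x hx => by simp only [z x hx, z' x hx, add_zero], fun x hx y hy w hw => ?_⟩
  linarith [t x hx y hy w hw, t' x hx y hy w hw]

theorem IsPseudometricOn.const_mul (hρ : IsPseudometricOn A ρ) {c : ℝ} (hc : 0 ≤ c) :
    IsPseudometricOn A fun x y => c * ρ x y := by
  obtain ⟨n, s, z, t⟩ := hρ
  refine ⟨fun x hx y hy => mul_nonneg hc (n x hx y hy),
    fun x hx y hy => by simp only [s x hx y hy],
    fun x hx => by simp only [z x hx, mul_zero], fun x hx y hy w hw => ?_⟩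
  rw [← mul_add]
  exact mul_le_mul_of_nonneg_left (t x hx y hy w hw) hc

variable {d : X → X → ℝ} {C D : ℝ}

theorem PMNormLE.add (hρ : PMNormLE d A ρ C) (hσ : PMNormLE d A σ D) :
    PMNormLE d A (fun x y => ρ x y + σ x y) (C + D) := fun x hx y hy => by
  linarith [hρ x hx y hy, hσ x hx y hy]

theorem PMNormLE.const_mul (hρ : PMNormLE d A ρ C) {c : ℝ} (hc : 0 ≤ c) :
    PMNormLE d A (fun x y => c * ρ x y) (c * C) := fun x hx y hy => by
  rw [mul_assoc]
  exact mul_le_mul_of_nonneg_left (hρ x hx y hy) hc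

theorem IsLipM.const_mul (hρ : IsLipM d A ρ) {c : ℝ} (hc : 0 < c) :
    IsLipM d A fun x y => c * ρ x y := by
  obtain ⟨⟨p, C, hC, hn⟩, hpos⟩ := hρ
  exact ⟨⟨p.const_mul hc.le, c * C, mul_pos hc hC, hn.const_mul hc.le⟩,
    fun x hx y hy hxy => mul_pos hc (hpos x hx y hy hxy)⟩

theorem IsLipPM.add_isLipM (hρ : IsLipPM d A ρ) (hσ : IsLipM d A σ) :
    IsLipM d A fun x y => ρ x y + σ x y := by
  obtain ⟨p, C, hC, hn⟩ := hρ
  obtain ⟨⟨q, D, hD, hm⟩, hpos⟩ := hσ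
  exact ⟨⟨p.add q, C + D, add_pos hC hD, hn.add hm⟩,
    fun x hx y hy hxy => add_pos_of_nonneg_of_pos (p.1 x hx y hy) (hpos x hx y hy hxy)⟩

/-- Pseudometrics are closed under limits along rays. -/
theorem isPseudometricOn_of_forall_add_mul
    (h : ∀ ε : ℝ, 0 < ε → IsPseudometricOn A fun x y => ρ x y + ε * σ x y) :
    IsPseudometricOn A ρ := by
  have key (a b : ℝ) (hab : ∀ ε : ℝ, 0 < ε → 0 ≤ a + ε * b) : 0 ≤ a := by
    have ht : Filter.Tendsto (fun ε : ℝ => a + ε * b) (nhdsWithin 0 (Ioi 0)) (nhds a) := by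
      have hc : Continuous fun ε : ℝ => a + ε * b := by fun_prop
      simpa using (hc.tendsto 0).mono_left nhdsWithin_le_nhds
    exact ge_of_tendsto ht (eventually_nhdsWithin_of_forall hab)
  refine ⟨fun x hx y hy => key _ (σ x y) fun ε hε => (h ε hε).1 x hx y hy,
    fun x hx y hy => ?_, fun x hx => ?_, fun x hx y hy z hz => ?_⟩
  · have h1 := (h 1 one_pos).2.1 x hx y hy
    have h2 := (h 2 two_pos).2.1 x hx y hy
    linarith
  · have h1 := (h 1 one_pos).2.2.1 x hx
    have h2 := (h 2 two_pos).2.2.1 x hx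
    linarith
  · refine sub_nonneg.1 (key _ (σ x y + σ y z - σ x z) fun ε hε => ?_)
    linarith [(h ε hε).2.2.2 x hx y hy z hz]

end Cone

theorem isLipM_dist {X : Type*} [MetricSpace X] (A : Set X) : IsLipM dist A dist :=
  ⟨⟨⟨fun _ _ _ _ => dist_nonneg, fun x _ y _ => dist_comm x y, fun x _ => dist_self x,
    fun x _ y _ z _ => dist_triangle x y z⟩, 1, one_pos, fun _ _ _ _ => (one_mul _).ge⟩,
    fun _ _ _ _ => dist_pos.2⟩

/-- Adding `ρ a b` times the collapsed distance turns an extension operator for pseudometrics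
into one for metrics. -/
theorem IsPMExtOp.exists_isMExtOp {X : Type*} [MetricSpace X] {S : Set X} (hS : IsClosed S)
    {a b : X} (ha : a ∈ S) (hb : b ∈ S) (hab : a ≠ b) {u : (X → X → ℝ) → X → X → ℝ} {M : ℝ}
    (hu : IsPMExtOp dist S univ u) (hM : PMOpNormLE dist S univ u M) :
    ∃ (w : (X → X → ℝ) → X → X → ℝ) (M : ℝ),
      IsMExtOp dist S univ w ∧ MOpNormLE dist S univ w M := by
  obtain ⟨hmap, hadd, hsmul, hext⟩ := hu
  have hcol : PMNormLE dist univ (collapseDist S) 1 := fun x _ y _ => by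
    rw [one_mul]; exact collapseDist_le_dist x y
  refine ⟨fun ρ x y => u ρ x y + ρ a b * collapseDist S x y, M + dist a b * 1,
    ⟨fun ρ hρ => ?_, fun ρ₁ ρ₂ h₁ h₂ => ?_, fun c hc ρ hρ => ?_, fun ρ hρ x hx y hy => ?_⟩,
    fun ρ hρ hρ1 x hx y hy => ?_⟩
  · have hpos : 0 < ρ a b := hρ.2 a ha b hb hab
    obtain ⟨p, C, hC, hn⟩ := hmap ρ hρ.1
    have q := isPseudometricOn_collapseDist (S := S)
    refine ⟨⟨p.add (q.const_mul hpos.le), C + ρ a b * 1, by positivity,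
      hn.add (hcol.const_mul hpos.le)⟩, fun x hx y hy hxy => ?_⟩
    by_cases h : x ∈ S ∧ y ∈ S
    · refine add_pos_of_pos_of_nonneg ?_ (mul_nonneg hpos.le (q.1 x hx y hy))
      rw [hext ρ hρ.1 x h.1 y h.2]
      exact hρ.2 x h.1 y h.2 hxy
    · exact add_pos_of_nonneg_of_pos (p.1 x hx y hy)
        (mul_pos hpos (collapseDist_pos hS ⟨a, ha⟩ hxy h))
  · simp only [hadd ρ₁ ρ₂ h₁.1 h₂.1]
    ext x y
    ring
  · simp only [hsmul c hc.le ρ hρ.1]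
    ext x y
    ring
  · simp only [hext ρ hρ.1 x hx y hy, collapseDist_eq_zero hx hy, mul_zero, add_zero]
  · have h1 := hM ρ hρ.1 hρ1 x hx y hy
    have h2 : ρ a b ≤ dist a b := by simpa using hρ1 a ha b hb
    have h3 := mul_le_mul h2 (collapseDist_le_dist (S := S) x y)
      (isPseudometricOn_collapseDist.1 x hx y hy) dist_nonneg
    linarith

/-- The operator `ρ ↦ w (ρ + d) - w d` extends pseudometrics when `w` extends metrics. -/
theorem IsMExtOp.exists_isPMExtOp {X : Type*} [MetricSpace X] {S : Set X}
    {w : (X → X → ℝ) → X → X → ℝ} {M : ℝ}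
    (hw : IsMExtOp dist S univ w) (hM : MOpNormLE dist S univ w M) :
    ∃ (u : (X → X → ℝ) → X → X → ℝ) (M : ℝ),
      IsPMExtOp dist S univ u ∧ PMOpNormLE dist S univ u M := by
  obtain ⟨hmap, hadd, hsmul, hext⟩ := hw
  have hd := isLipM_dist S
  have hwd := (hmap _ hd).1.1.1
  have hsum {ρ : X → X → ℝ} (hρ : IsLipPM dist S ρ) :
      IsLipM dist S fun x y => ρ x y + dist x y := hρ.add_isLipM hd
  have hle (ρ : X → X → ℝ) (x y : X) :
      w (fun x y => ρ x y + dist x y) x y - w dist x y ≤ w (fun x y => ρ x y + dist x y) x y :=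
    sub_le_self _ (hwd x (mem_univ x) y (mem_univ y))
  have hray {ρ : X → X → ℝ} (hρ : IsLipPM dist S ρ) {ε : ℝ} (hε : 0 < ε) (x y : X) :
      w (fun x y => ρ x y + dist x y) x y - w dist x y + ε * w dist x y =
        w (fun x y => ρ x y + ε * dist x y) x y := by
    have h1 := hadd _ _ (hsum hρ) (hd.const_mul hε)
    have h2 := hadd _ _ (hρ.add_isLipM (hd.const_mul hε)) hd
    have h3 : (fun x y => ρ x y + dist x y + ε * dist x y) =
        fun x y => ρ x y + ε * dist x y + dist x y := by
      ext x y
      ring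
    rw [h3, h2, hsmul ε hε _ hd] at h1
    have h4 := congrFun (congrFun h1 x) y
    simp only at h4
    linarith
  refine ⟨fun ρ x y => w (fun x y => ρ x y + dist x y) x y - w dist x y, 2 * M,
    ⟨fun ρ hρ => ⟨?_, ?_⟩, fun ρ₁ ρ₂ h₁ h₂ => ?_, fun c hc ρ hρ => ?_,
      fun ρ hρ x hx y hy => ?_⟩, fun ρ hρ hρ1 x hx y hy => ?_⟩
  · refine isPseudometricOn_of_forall_add_mul (σ := w dist) fun ε hε => ?_
    simp only [hray hρ hε]
    exact (hmap _ (hρ.add_isLipM (hd.const_mul hε))).1.1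
  · obtain ⟨C, hC, hn⟩ := (hmap _ (hsum hρ)).1.2
    exact ⟨C, hC, fun x hx y hy => (hle ρ x y).trans (hn x hx y hy)⟩
  · have h12 : IsLipM dist S fun x y => ρ₁ x y + (ρ₂ x y + dist x y) := h₁.add_isLipM (hsum h₂)
    have h := hadd _ _ (hsum h₁) (hsum h₂)
    have h' := hadd _ _ h12 hd
    have h3 : (fun x y => ρ₁ x y + dist x y + (ρ₂ x y + dist x y)) =
        fun x y => ρ₁ x y + (ρ₂ x y + dist x y) + dist x y := by
      ext x y
      ring
    rw [h3, h'] at h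
    ext x y
    have h4 := congrFun (congrFun h x) y
    simp only [add_assoc] at h4 ⊢
    linarith
  · rcases hc.eq_or_lt with rfl | hc
    · simp
    · have hcρ : IsLipPM dist S fun x y => c * ρ x y := by
        obtain ⟨p, C, hC, hn⟩ := hρ
        exact ⟨p.const_mul hc.le, c * C, mul_pos hc hC, hn.const_mul hc.le⟩
      ext x y
      have h1 := hray hcρ hc x y
      have h2 := congrFun (congrFun (hsmul c hc _ (hsum hρ)) x) y
      simp only [mul_add] at h2
      rw [h2] at h1
      linarith
  · simp only [hext _ (hsum hρ) x hx y hy, hext _ hd x hx y hy, add_sub_cancel_right]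
  · refine (hle ρ x y).trans ?_
    have hhalf : (0 : ℝ) < 1 / 2 := by norm_num
    have hn : PMNormLE dist S (fun x y => 1 / 2 * (ρ x y + dist x y)) 1 := fun x hx y hy => by
      linarith [hρ1 x hx y hy]
    have h := hM _ ((hsum hρ).const_mul hhalf) hn x hx y hy
    rw [hsmul _ hhalf _ (hsum hρ)] at h
    linarith

/-- For a closed subset `S` (with at least two points) of a compact metric space `X`,
there is a continuous linear extension operator for Lipschitz pseudometrics from `S` to `X`
iff there is one for Lipschitz metrics. -/
theorem pm_extension_iff_m_extension {X : Type*} [MetricSpace X] [CompactSpace X]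
    (S : Set X) (hS : IsClosed S) (htwo : ∃ x ∈ S, ∃ y ∈ S, x ≠ y) :
    (∃ (u : (X → X → ℝ) → X → X → ℝ) (M : ℝ),
        IsPMExtOp dist S univ u ∧ PMOpNormLE dist S univ u M) ↔
    (∃ (w : (X → X → ℝ) → X → X → ℝ) (M : ℝ),
        IsMExtOp dist S univ w ∧ MOpNormLE dist S univ w M) := by
  obtain ⟨a, ha, b, hb, hab⟩ := htwo
  exact ⟨fun ⟨_, _, hu, hM⟩ => hu.exists_isMExtOp hS ha hb hab hM,
    fun ⟨_, _, hw, hM⟩ => hw.exists_isPMExtOp hM⟩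
end

section
/- Let S be a closed subset of a compact metric space (X,d) with at least two points, let u : PM_Lip(S) → PM_Lip(X) be an extension operator for Lipschitz pseudometrics with finite norm ‖u‖, let ρ̃ be a Lipschitz pseudometric on X with ρ̃(x,y) = 0 if and only if x = y or (x ∈ S and y ∈ S), and let x₀, y₀ ∈ S with x₀ ≠ y₀. Then the map ũ defined by ũ(δ) = u(δ) + δ(x₀,y₀)·ρ̃ is an extension operator from the Lipschitz metrics on S to the Lipschitz metrics on X: ũ is additive and positively homogeneous, ũ(δ)|_{S×S} = δ for every δ ∈ M_Lip(S), ũ(δ) ∈ M_Lip(X) for every δ ∈ M_Lip(S), and sup{‖ũ(δ)‖_X : δ ∈ M_Lip(S), ‖δ‖_S ≤ 1} is finite. -/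
open Set

theorem IsPseudometricOn.add_s11 {X : Type*} {A : Set X} {ρ₁ ρ₂ : X → X → ℝ}
    (h₁ : IsPseudometricOn A ρ₁) (h₂ : IsPseudometricOn A ρ₂) :
    IsPseudometricOn A (fun a b => ρ₁ a b + ρ₂ a b) := by
  obtain ⟨nonneg₁, symm₁, diag₁, tri₁⟩ := h₁
  obtain ⟨nonneg₂, symm₂, diag₂, tri₂⟩ := h₂
  refine ⟨fun x hx y hy => add_nonneg (nonneg₁ x hx y hy) (nonneg₂ x hx y hy),
    fun x hx y hy => ?_, fun x hx => ?_, fun x hx y hy z hz => ?_⟩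
  · simp only [symm₁ x hx y hy, symm₂ x hx y hy]
  · simp only [diag₁ x hx, diag₂ x hx, add_zero]
  · linarith [tri₁ x hx y hy z hz, tri₂ x hx y hy z hz]

theorem IsPseudometricOn.const_mul_s11 {X : Type*} {A : Set X} {ρ : X → X → ℝ} {c : ℝ}
    (hc : 0 ≤ c) (h : IsPseudometricOn A ρ) :
    IsPseudometricOn A (fun a b => c * ρ a b) := by
  obtain ⟨nonneg, symm, diag, tri⟩ := h
  refine ⟨fun x hx y hy => mul_nonneg hc (nonneg x hx y hy),
    fun x hx y hy => ?_, fun x hx => ?_, fun x hx y hy z hz => ?_⟩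
  · simp only [symm x hx y hy]
  · simp only [diag x hx, mul_zero]
  · simpa only [mul_add] using mul_le_mul_of_nonneg_left (tri x hx y hy z hz) hc

theorem PMNormLE.add_const_mul {X : Type*} {d : X → X → ℝ} {A : Set X}
    {ρ₁ ρ₂ : X → X → ℝ} {M₁ M₂ c : ℝ} (hc : 0 ≤ c)
    (h₁ : PMNormLE d A ρ₁ M₁) (h₂ : PMNormLE d A ρ₂ M₂) :
    PMNormLE d A (fun a b => ρ₁ a b + c * ρ₂ a b) (M₁ + c * M₂) := fun x hx y hy =>
  calc ρ₁ x y + c * ρ₂ x y ≤ M₁ * d x y + c * (M₂ * d x y) :=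
        add_le_add (h₁ x hx y hy) (mul_le_mul_of_nonneg_left (h₂ x hx y hy) hc)
    _ = (M₁ + c * M₂) * d x y := by ring

theorem IsLipPM.add_const_mul {X : Type*} {d : X → X → ℝ} {A : Set X}
    {ρ₁ ρ₂ : X → X → ℝ} {c : ℝ} (hc : 0 ≤ c) (h₁ : IsLipPM d A ρ₁) (h₂ : IsLipPM d A ρ₂) :
    IsLipPM d A (fun a b => ρ₁ a b + c * ρ₂ a b) := by
  obtain ⟨p₁, C₁, pos₁, le₁⟩ := h₁
  obtain ⟨p₂, C₂, pos₂, le₂⟩ := h₂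
  exact ⟨p₁.add_s11 (p₂.const_mul_s11 hc), C₁ + c * C₂, by positivity, le₁.add_const_mul hc le₂⟩

/-- Given an extension operator `u` for Lipschitz pseudometrics from `S` to `X` of norm
at most `M`, a Lipschitz pseudometric `ρ` on `X` vanishing exactly on `(S × S) ∪ Δ_X`,
and points `x₀ ≠ y₀` in `S`, the map `δ ↦ u(δ) + δ(x₀,y₀)·ρ` is an extension operator
from the Lipschitz metrics on `S` to the Lipschitz metrics on `X`, of finite norm. -/
theorem tilde_u_is_metric_extension_operator {X : Type*} [MetricSpace X] [CompactSpace X]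
    (S : Set X) (hS : IsClosed S)
    (u : (X → X → ℝ) → X → X → ℝ) (M : ℝ)
    (hu : IsPMExtOp dist S univ u) (huM : PMOpNormLE dist S univ u M)
    (ρ : X → X → ℝ) (hρ : IsLipPM dist univ ρ)
    (hρ0 : ∀ x y : X, ρ x y = 0 ↔ x = y ∨ (x ∈ S ∧ y ∈ S))
    (x₀ y₀ : X) (hx₀ : x₀ ∈ S) (hy₀ : y₀ ∈ S) (hne : x₀ ≠ y₀) :
    IsMExtOp dist S univ (fun δ a b => u δ a b + δ x₀ y₀ * ρ a b) ∧
      ∃ M' : ℝ, MOpNormLE dist S univ (fun δ a b => u δ a b + δ x₀ y₀ * ρ a b) M' := by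
  obtain ⟨u_lip, u_add, u_smul, u_ext⟩ := hu
  have base_pos : ∀ δ, IsLipM dist S δ → 0 < δ x₀ y₀ := fun δ hδ => hδ.2 x₀ hx₀ y₀ hy₀ hne
  refine ⟨⟨fun δ hδ => ⟨(u_lip δ hδ.1).add_const_mul (base_pos δ hδ).le hρ, ?_⟩,
    fun δ₁ δ₂ h₁ h₂ => ?_, fun c hc δ hδ => ?_, fun δ hδ x hx y hy => ?_⟩, ?_⟩
  · intro x _ y _ hxy
    have u_nonneg := (u_lip δ hδ.1).1.1 x (mem_univ x) y (mem_univ y)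
    have ρ_nonneg := hρ.1.1 x (mem_univ x) y (mem_univ y)
    by_cases hS' : x ∈ S ∧ y ∈ S
    · have u_pos : 0 < u δ x y := by
        rw [u_ext δ hδ.1 x hS'.1 y hS'.2]
        exact hδ.2 x hS'.1 y hS'.2 hxy
      exact add_pos_of_pos_of_nonneg u_pos (mul_nonneg (base_pos δ hδ).le ρ_nonneg)
    · have ρ_ne : ρ x y ≠ 0 := fun h => ((hρ0 x y).1 h).elim hxy hS'
      exact add_pos_of_nonneg_of_pos u_nonneg
        (mul_pos (base_pos δ hδ) (lt_of_le_of_ne ρ_nonneg ρ_ne.symm))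
  · funext a b
    simp only [u_add δ₁ δ₂ h₁.1 h₂.1]
    ring
  · funext a b
    simp only [u_smul c hc.le δ hδ.1]
    ring
  · simp only [u_ext δ hδ.1 x hx y hy, (hρ0 x y).2 (Or.inr ⟨hx, hy⟩), mul_zero, add_zero]
  · obtain ⟨C, C_pos, hC⟩ := hρ.2
    refine ⟨M + dist x₀ y₀ * C, fun δ hδ hδ1 x hx y hy => ?_⟩
    have base_le : δ x₀ y₀ ≤ dist x₀ y₀ := by simpa using hδ1 x₀ hx₀ y₀ hy₀
    refine ((huM δ hδ.1 hδ1).add_const_mul (base_pos δ hδ).le hC x hx y hy).trans ?_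
    gcongr
end
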